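/- Assume T(𝓛) acts transitively on 𝓛, is imprimitive, and contains a long cycle (a cycle of length |𝓛|). Then there exist disjoint sets E₁, E₂ ⊆ E and collections 𝓛₁ of subsets of E₁ and 𝓛₂ of subsets of E₂ such that 𝓛 = 𝓛₁ ⊗ 𝓛₂ = {X₁ ∪ X₂ : X₁ ∈ 𝓛₁, X₂ ∈ 𝓛₂}, with |𝓛₁| ≥ 2, |𝓛₂| ≥ 2, gcd(|𝓛₁|, |𝓛₂|) = 1, and each of T(𝓛₁) and T(𝓛₂) contains a long cycle. -/

import Mathlib

open scoped symmDiff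

namespace TogglePaper

variable {E : Type*} [DecidableEq E]

/-- The toggle `τ_e` on the collection `L` of subsets of the ground set. -/
def toggle (L : Finset (Finset E)) (e : E) : Equiv.Perm {A : Finset E // A ∈ L} :=
  Function.Involutive.toPerm
    (fun X => if h : X.1 ∆ ({e} : Finset E) ∈ L then ⟨X.1 ∆ ({e} : Finset E), h⟩ else X)
    (by
      intro X
      by_cases h : X.1 ∆ ({e} : Finset E) ∈ L
      · have h2 : (X.1 ∆ ({e} : Finset E)) ∆ ({e} : Finset E) = X.1 :=
          symmDiff_symmDiff_cancel_right _ _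
        simp only [dif_pos h, h2]
        simp [h2, X.2]
      · simp [h])

/-- The generalized toggle group `T(L)`. -/
def toggleGroup (L : Finset (Finset E)) : Subgroup (Equiv.Perm {A : Finset E // A ∈ L}) :=
  Subgroup.closure (Set.range (toggle L))

/-- `T(L)` acts transitively on `L`. -/
def IsTransitive (L : Finset (Finset E)) : Prop :=
  ∀ A B : {A : Finset E // A ∈ L}, ∃ g ∈ toggleGroup L, g A = B

/-- `B` is a block for the action of `T(L)` on `L`. -/
def IsBlock (L : Finset (Finset E)) (B : Finset {A : Finset E // A ∈ L}) : Prop :=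
  ∀ g ∈ toggleGroup L, Finset.image g B = B ∨ Disjoint (Finset.image g B) B

/-- `Blocks` is a block system for `T(L)`: a partition of `L` into nonempty blocks
that is permuted by every element of `T(L)`. -/
def IsBlockSystem (L : Finset (Finset E))
    (Blocks : Finset (Finset {A : Finset E // A ∈ L})) : Prop :=
  (∀ B ∈ Blocks, B.Nonempty) ∧
  (∀ A : {A : Finset E // A ∈ L}, ∃! B : Finset {A : Finset E // A ∈ L},
      B ∈ Blocks ∧ A ∈ B) ∧
  (∀ g ∈ toggleGroup L, ∀ B ∈ Blocks, Finset.image g B ∈ Blocks)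

/-- An element `g` of `T(L)` is type 2 (with respect to a fixed block system `Blocks`)
if it maps each block to itself; it is type 1 otherwise. -/
def IsType2 (L : Finset (Finset E)) (Blocks : Finset (Finset {A : Finset E // A ∈ L}))
    (g : Equiv.Perm {A : Finset E // A ∈ L}) : Prop :=
  ∀ B ∈ Blocks, Finset.image g B = B

/-- The action of `T(L)` on `L` is primitive: it is transitive and the only blocks
are the singletons, the empty set and the whole set. -/
def IsPrimitive (L : Finset (Finset E)) : Prop :=
  IsTransitive L ∧
    ∀ B : Finset {A : Finset E // A ∈ L}, IsBlock L B → B.card ≤ 1 ∨ B = Finset.univ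

/-- `T(L)` contains a long cycle, i.e. a cycle whose support is all of `L`. -/
def HasLongCycle (L : Finset (Finset E)) : Prop :=
  ∃ g ∈ toggleGroup L, g.IsCycle ∧ g.support = Finset.univ

section Toggle

variable {L : Finset (Finset E)} {e : E} {X : {A : Finset E // A ∈ L}}

theorem toggle_val_of_mem (h : X.1 ∆ {e} ∈ L) : (toggle L e X).1 = X.1 ∆ {e} := by
  simp [toggle, Function.Involutive.toPerm, h]

theorem toggle_of_notMem (h : X.1 ∆ {e} ∉ L) : toggle L e X = X := by
  simp [toggle, Function.Involutive.toPerm, h]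

theorem toggle_val_of_ne (h : toggle L e X ≠ X) : (toggle L e X).1 = X.1 ∆ {e} :=
  toggle_val_of_mem (not_not.1 (mt toggle_of_notMem h))

theorem toggle_toggle (L : Finset (Finset E)) (e : E) (X : {A : Finset E // A ∈ L}) :
    toggle L e (toggle L e X) = X :=
  Function.Involutive.toPerm_involutive _ X

theorem toggle_inv (L : Finset (Finset E)) (e : E) : (toggle L e)⁻¹ = toggle L e := by
  ext1 X
  rw [Equiv.Perm.inv_eq_iff_eq, toggle_toggle]

theorem toggle_mem (L : Finset (Finset E)) (e : E) : toggle L e ∈ toggleGroup L :=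
  Subgroup.subset_closure ⟨e, rfl⟩

theorem toggleGroup_induction {p : ∀ g, g ∈ toggleGroup L → Prop} (one : p 1 (one_mem _))
    (toggle_mul : ∀ e g hg, p g hg → p (toggle L e * g) (mul_mem (toggle_mem L e) hg))
    {g : Equiv.Perm {A : Finset E // A ∈ L}} (hg : g ∈ toggleGroup L) : p g hg := by
  induction hg using Subgroup.closure_induction_left with
  | one => exact one
  | mul_left x hx y hy ih =>
    obtain ⟨e, rfl⟩ := hx
    exact toggle_mul e y hy ih
  | inv_mul_cancel x hx y hy ih =>
    obtain ⟨e, rfl⟩ := hx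
    simp only [toggle_inv]
    exact toggle_mul e y hy ih

end Toggle

/-- An equivalence relation on `L` that is preserved by the toggle group. -/
structure IsCongruence (L : Finset (Finset E))
    (r : {A : Finset E // A ∈ L} → {A : Finset E // A ∈ L} → Prop) : Prop where
  equivalence : Equivalence r
  map : ∀ g ∈ toggleGroup L, ∀ X Y, r X Y → r (g X) (g Y)

theorem IsBlock.mem_of_mem {L : Finset (Finset E)} {B : Finset {A : Finset E // A ∈ L}}
    (hB : IsBlock L B) {g : Equiv.Perm {A : Finset E // A ∈ L}} (hg : g ∈ toggleGroup L)
    {X Y : {A : Finset E // A ∈ L}} (hX : X ∈ B) (hY : Y ∈ B) (hgX : g X ∈ B) : g Y ∈ B := by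
  rcases hB g hg with h | h
  · rw [← h]
    exact Finset.mem_image_of_mem _ hY
  · exact absurd hgX (Finset.disjoint_left.1 h (Finset.mem_image_of_mem _ hX))

/-- A nonempty block of a transitive toggle group is a class of a congruence. -/
theorem IsBlock.exists_isCongruence {L : Finset (Finset E)} (htrans : IsTransitive L)
    {B : Finset {A : Finset E // A ∈ L}} (hB : IsBlock L B) (hne : B.Nonempty) :
    ∃ r, IsCongruence L r ∧ ∀ X ∈ B, ∀ Y, r X Y ↔ Y ∈ B := by
  refine ⟨fun X Y => ∃ g ∈ toggleGroup L, g X ∈ B ∧ g Y ∈ B, ⟨⟨?_, ?_, ?_⟩, ?_⟩, ?_⟩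
  · intro X
    obtain ⟨Z, hZ⟩ := hne
    obtain ⟨g, hg, rfl⟩ := htrans X Z
    exact ⟨g, hg, hZ, hZ⟩
  · rintro X Y ⟨g, hg, hX, hY⟩
    exact ⟨g, hg, hY, hX⟩
  · rintro X Y Z ⟨g, hg, hX, hY⟩ ⟨h, hh, hY', hZ⟩
    refine ⟨h, hh, ?_, hZ⟩
    have := hB.mem_of_mem (mul_mem hh (inv_mem hg)) hY hX (by simpa using hY')
    simpa using this
  · rintro k hk X Y ⟨g, hg, hX, hY⟩
    exact ⟨g * k⁻¹, mul_mem hg (inv_mem hk), by simpa using hX, by simpa using hY⟩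
  · intro X hX Y
    refine ⟨?_, fun hY => ⟨1, one_mem _, hX, hY⟩⟩
    rintro ⟨g, hg, hgX, hgY⟩
    have := hB.mem_of_mem (inv_mem hg) hgX hgY (by simpa using hX)
    simpa using this

namespace IsCongruence

variable {L : Finset (Finset E)}
  {r : {A : Finset E // A ∈ L} → {A : Finset E // A ∈ L} → Prop}

theorem toggle_rel (hr : IsCongruence L r) (e : E) {X Y : {A : Finset E // A ∈ L}}
    (h : r X Y) : r (toggle L e X) (toggle L e Y) :=
  hr.map _ (toggle_mem L e) _ _ h

theorem rel_toggle_iff (hr : IsCongruence L r) (e : E) {X Y : {A : Finset E // A ∈ L}}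
    (h : r X Y) : r X (toggle L e X) ↔ r Y (toggle L e Y) := by
  have h' := hr.toggle_rel e h
  have heq := hr.equivalence
  exact ⟨fun k => heq.trans (heq.symm h) (heq.trans k h'),
    fun k => heq.trans h (heq.trans k (heq.symm h'))⟩

theorem toggle_ne (hr : IsCongruence L r) {e : E} {X : {A : Finset E // A ∈ L}}
    (h : ¬ r X (toggle L e X)) : toggle L e X ≠ X := by
  intro h'
  rw [h'] at h
  exact h (hr.equivalence.refl X)

/-- All classes of a congruence are translates of each other, by sets of elements whose toggles
move some class. -/
theorem exists_translate (hr : IsCongruence L r) {g : Equiv.Perm {A : Finset E // A ∈ L}}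
    (hg : g ∈ toggleGroup L) (X : {A : Finset E // A ∈ L}) :
    ∃ D : Finset E, (∀ e ∈ D, ∃ Z, ¬ r Z (toggle L e Z)) ∧
      ∀ Y, r Y X → ∃ h : Y.1 ∆ D ∈ L, r ⟨Y.1 ∆ D, h⟩ (g X) := by
  have heq := hr.equivalence
  induction hg using toggleGroup_induction with
  | one =>
    refine ⟨∅, by simp, fun Y hY => ?_⟩
    have : Y.1 ∆ (∅ : Finset E) = Y.1 := symmDiff_bot _
    simpa only [this, Y.2, exists_true_left, Equiv.Perm.one_apply] using hY
  | toggle_mul e g hg ih =>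
    obtain ⟨D, hD, hDY⟩ := ih
    by_cases he : r (g X) (toggle L e (g X))
    · refine ⟨D, hD, fun Y hY => ?_⟩
      obtain ⟨h, h'⟩ := hDY Y hY
      exact ⟨h, heq.trans h' he⟩
    · refine ⟨D ∆ {e}, fun d hd => ?_, fun Y hY => ?_⟩
      · rcases Finset.mem_symmDiff.1 hd with hd | hd
        · exact hD d hd.1
        · rw [Finset.mem_singleton.1 hd.1]
          exact ⟨_, he⟩
      · obtain ⟨h, h'⟩ := hDY Y hY
        have hne := hr.toggle_ne (mt (hr.rel_toggle_iff e h').1 he)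
        have hval := toggle_val_of_ne hne
        have h'' := hr.toggle_rel e h'
        rw [← symmDiff_assoc]
        refine ⟨hval ▸ (toggle L e _).2, ?_⟩
        rw [Equiv.Perm.mul_apply]
        convert h'' using 1
        exact Subtype.ext hval.symm

/-- A toggle moving some class fixes pointwise every class that it preserves. -/
theorem toggle_eq_self (hr : IsCongruence L r) (htrans : IsTransitive L) {e : E}
    (he : ∃ Z, ¬ r Z (toggle L e Z)) {X : {A : Finset E // A ∈ L}}
    (hX : r X (toggle L e X)) : toggle L e X = X := by
  have heq := hr.equivalence
  by_contra hne
  obtain ⟨Z, hZ⟩ := he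
  obtain ⟨g, hg, rfl⟩ := htrans X Z
  obtain ⟨D, -, hD⟩ := hr.exists_translate hg X
  obtain ⟨h₁, h₁'⟩ := hD X (heq.refl X)
  obtain ⟨h₂, h₂'⟩ := hD _ (heq.symm hX)
  have hmove := mt (hr.rel_toggle_iff e h₁').1 hZ
  apply hmove
  have hval := toggle_val_of_ne (hr.toggle_ne hmove)
  have hval' := toggle_val_of_ne hne
  convert heq.trans h₁' (heq.symm h₂') using 1
  apply Subtype.ext
  rw [hval]
  simp only [hval']
  rw [symmDiff_right_comm]

theorem transversal_toggle (hr : IsCongruence L r) (d : E) {ι : Type*}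
    {x : ι → {A : Finset E // A ∈ L}} (hx : ∀ Z, ∃! i, r (x i) Z) (Z : {A : Finset E // A ∈ L}) :
    ∃! i, r (toggle L d (x i)) Z := by
  obtain ⟨i, hi, hiu⟩ := hx (toggle L d Z)
  refine ⟨i, ?_, fun j hj => hiu j ?_⟩
  · simpa only [toggle_toggle] using hr.toggle_rel d hi
  · simpa only [toggle_toggle] using hr.toggle_rel d hj

theorem sum_transversal_toggle (hr : IsCongruence L r) (htrans : IsTransitive L) {e : E}
    (he : ∃ Z, ¬ r Z (toggle L e Z)) (d : E) {ι : Type*} [Fintype ι]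
    {x : ι → {A : Finset E // A ∈ L}} (hx : ∀ Z, ∃! i, r (x i) Z) :
    ∑ i, (if e ∈ (toggle L d (x i)).1 then 1 else 0 : ZMod 2)
      = ∑ i, if e ∈ (x i).1 then 1 else 0 := by
  classical
  have heq := hr.equivalence
  rcases eq_or_ne d e with rfl | hde
  · rw [← sub_eq_zero, ← Finset.sum_sub_distrib]
    choose σ hσ hσu using hx
    have key : ∀ Y : {A : Finset E // A ∈ L},
        ((if d ∈ (toggle L d Y).1 then 1 else 0) - (if d ∈ Y.1 then 1 else 0) : ZMod 2)
          = if r Y (toggle L d Y) then 0 else 1 := by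
      intro Y
      by_cases h : r Y (toggle L d Y)
      · rw [if_pos h, hr.toggle_eq_self htrans he h, sub_self]
      · simp only [toggle_val_of_ne (hr.toggle_ne h)]
        by_cases hd : d ∈ Y.1 <;> simp [h, hd, Finset.mem_symmDiff]
    simp only [key]
    refine Finset.sum_involution (fun i _ => σ (toggle L d (x i))) ?_ ?_ ?_ ?_
    · intro i _
      have h₁ := hr.rel_toggle_iff d (hσ (toggle L d (x i)))
      rw [toggle_toggle] at h₁
      have h₂ : r (x i) (toggle L d (x i)) ↔ r (toggle L d (x i)) (x i) :=
        ⟨heq.symm, heq.symm⟩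
      simp only [h₁, h₂]
      split_ifs
      · simp
      · decide
    · intro i _ hi h
      have := hσ (toggle L d (x i))
      simp only [h] at this
      simp [this] at hi
    · simp
    · intro i _
      refine (hσu _ i ?_).symm
      have := hr.toggle_rel d (hσ (toggle L d (x i)))
      rw [toggle_toggle] at this
      exact heq.symm this
  · refine Finset.sum_congr rfl fun i _ => ?_
    by_cases h : toggle L d (x i) = x i
    · simp only [h]
    · simp [toggle_val_of_ne h, Finset.mem_symmDiff, hde.symm]

/-- The parity of the number of sets containing `e` in a transversal of the classes is invariant
under the toggle group, provided the toggle of `e` moves some class. -/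
theorem sum_transversal (hr : IsCongruence L r) (htrans : IsTransitive L) {e : E}
    (he : ∃ Z, ¬ r Z (toggle L e Z)) {ι : Type*} [Fintype ι]
    {g : Equiv.Perm {A : Finset E // A ∈ L}} (hg : g ∈ toggleGroup L)
    {x : ι → {A : Finset E // A ∈ L}} (hx : ∀ Z, ∃! i, r (x i) Z) :
    ∑ i, (if e ∈ (g (x i)).1 then 1 else 0 : ZMod 2) = ∑ i, if e ∈ (x i).1 then 1 else 0 := by
  suffices H : (∑ i, (if e ∈ (g (x i)).1 then 1 else 0 : ZMod 2)
      = ∑ i, if e ∈ (x i).1 then 1 else 0) ∧ ∀ Z, ∃! i, r (g (x i)) Z from H.1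
  induction hg using toggleGroup_induction with
  | one => exact ⟨rfl, hx⟩
  | toggle_mul d g hg ih =>
    exact ⟨(hr.sum_transversal_toggle htrans he d ih.2).trans ih.1,
      hr.transversal_toggle d ih.2⟩

/-- If a cyclic subgroup of the toggle group is transitive, then the sets in one class agree on
every element whose toggle moves some class. -/
theorem mem_iff_mem (hr : IsCongruence L r) (htrans : IsTransitive L) {e : E}
    (he : ∃ Z, ¬ r Z (toggle L e Z)) {c : Equiv.Perm {A : Finset E // A ∈ L}}
    (hc : c ∈ toggleGroup L) (hct : ∀ X Y, ∃ n : ℕ, (c ^ n) X = Y)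
    {X Y : {A : Finset E // A ∈ L}} (h : r X Y) : e ∈ X.1 ↔ e ∈ Y.1 := by
  classical
  have heq := hr.equivalence
  have hpow (n : ℕ) {X Y} (h : r X Y) : r ((c ^ n) X) ((c ^ n) Y) :=
    hr.map _ (pow_mem hc n) _ _ h
  obtain ⟨n, rfl⟩ := hct X Y
  induction n using Nat.strong_induction_on generalizing X with
  | _ n ih =>
    rcases Nat.eq_zero_or_pos n with rfl | hn
    · simp
    have hex : ∃ m, 0 < m ∧ r X ((c ^ m) X) := ⟨n, hn, h⟩
    obtain ⟨m, ⟨hm, hmX⟩, hmin⟩ : ∃ m, (0 < m ∧ r X ((c ^ m) X)) ∧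
        ∀ k < m, ¬ (0 < k ∧ r X ((c ^ k) X)) :=
      ⟨Nat.find hex, Nat.find_spec hex, fun k hk => Nat.find_min hex hk⟩
    have hmn : m ≤ n := by
      by_contra! hlt
      exact hmin n hlt ⟨hn, h⟩
    have hsplit : ∀ k, m ≤ k → (c ^ k) X = (c ^ (k - m)) ((c ^ m) X) := fun k hk => by
      rw [← Equiv.Perm.mul_apply, ← pow_add, Nat.sub_add_cancel hk]
    have hcover : ∀ k, ∃ i < m, r ((c ^ i) X) ((c ^ k) X) := by
      intro k
      induction k using Nat.strong_induction_on with
      | _ k ihk =>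
        rcases lt_or_ge k m with hk | hk
        · exact ⟨k, hk, heq.refl _⟩
        · obtain ⟨i, hi, hik⟩ := ihk (k - m) (by omega)
          refine ⟨i, hi, heq.trans hik ?_⟩
          rw [hsplit k hk]
          exact hpow _ hmX
    have hinj : ∀ i j, i < j → j < m → ¬ r ((c ^ i) X) ((c ^ j) X) := by
      intro i j hij hj hrij
      refine hmin (j - i) (by omega) ⟨by omega, ?_⟩
      have := hr.map _ (inv_mem (pow_mem hc i)) _ _ hrij
      rw [← Nat.add_sub_cancel' hij.le, pow_add] at this
      simpa using this
    have htr : ∀ Z, ∃! i : Fin m, r ((c ^ (i : ℕ)) X) Z := by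
      intro Z
      obtain ⟨k, rfl⟩ := hct X Z
      obtain ⟨i, hi, hik⟩ := hcover k
      refine ⟨⟨i, hi⟩, hik, fun j hj => ?_⟩
      have hij : r ((c ^ i) X) ((c ^ (j : ℕ)) X) := heq.trans hik (heq.symm hj)
      rcases lt_trichotomy i (j : ℕ) with hlt | heq' | hlt
      · exact absurd hij (hinj i j hlt j.2)
      · exact Fin.ext heq'.symm
      · exact absurd (heq.symm hij) (hinj j i hlt hi)
    have hsum := hr.sum_transversal htrans he hc htr
    simp only [← Equiv.Perm.mul_apply, ← pow_succ'] at hsum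
    rw [Fin.sum_univ_eq_sum_range (fun i => if e ∈ ((c ^ (i + 1)) X).1 then (1 : ZMod 2) else 0),
      Fin.sum_univ_eq_sum_range (fun i => if e ∈ ((c ^ i) X).1 then (1 : ZMod 2) else 0)] at hsum
    have hs := (Finset.sum_range_succ
      (fun i => if e ∈ ((c ^ i) X).1 then (1 : ZMod 2) else 0) m).symm.trans
      (Finset.sum_range_succ' (fun i => if e ∈ ((c ^ i) X).1 then (1 : ZMod 2) else 0) m)
    rw [hsum] at hs
    replace hs := add_left_cancel hs
    rw [pow_zero, Equiv.Perm.one_apply] at hs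
    have hX : e ∈ X.1 ↔ e ∈ ((c ^ m) X).1 := by
      by_cases h₁ : e ∈ X.1 <;> by_cases h₂ : e ∈ ((c ^ m) X).1 <;>
        simp only [h₁, h₂, if_true, if_false, zero_ne_one, one_ne_zero] at hs ⊢
    rw [hX, hsplit n hmn]
    refine ih (n - m) (by omega) ?_
    rw [← hsplit n hmn]
    exact heq.trans (heq.symm hmX) h

end IsCongruence

section Product

variable {L : Finset (Finset E)} {F : Finset E}

/-- The trace of the collection `L` on the set `F`. -/
def trace (L : Finset (Finset E)) (F : Finset E) : Finset (Finset E) :=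
  L.image (· ∩ F)

/-- The trace on `F` of a member of `L`. -/
def traceMap (L : Finset (Finset E)) (F : Finset E) (X : {A : Finset E // A ∈ L}) :
    {A : Finset E // A ∈ trace L F} :=
  ⟨X.1 ∩ F, Finset.mem_image_of_mem _ X.2⟩

theorem traceMap_surjective : Function.Surjective (traceMap L F) := by
  rintro ⟨A, hA⟩
  obtain ⟨X, hX, rfl⟩ := Finset.mem_image.1 hA
  exact ⟨⟨X, hX⟩, rfl⟩

theorem traceMap_toggle (hF : ∀ X ∈ L, ∀ Y ∈ L, (X ∩ F) ∪ (Y \ F) ∈ L) (e : E)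
    (X : {A : Finset E // A ∈ L}) :
    traceMap L F (toggle L e X) = toggle (trace L F) e (traceMap L F X) := by
  by_cases he : e ∈ F
  · have hcomm : (X.1 ∩ F) ∆ {e} = (X.1 ∆ {e}) ∩ F := by
      ext a
      by_cases ha : a = e
      · subst ha; simp [Finset.mem_symmDiff, he]
      · simp [Finset.mem_symmDiff, ha]
    by_cases h : X.1 ∆ {e} ∈ L
    · have h' : (traceMap L F X).1 ∆ {e} ∈ trace L F :=
        hcomm ▸ Finset.mem_image_of_mem _ h
      apply Subtype.ext
      rw [toggle_val_of_mem h']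
      change (toggle L e X).1 ∩ F = (X.1 ∩ F) ∆ {e}
      rw [toggle_val_of_mem h, hcomm]
    · have h' : (traceMap L F X).1 ∆ {e} ∉ trace L F := by
        intro h'
        obtain ⟨Y, hY, hYX⟩ := Finset.mem_image.1 h'
        apply h
        convert hF Y hY X.1 X.2 using 1
        change Y ∩ F = (X.1 ∩ F) ∆ {e} at hYX
        rw [hYX]
        ext a
        by_cases ha : a = e
        · subst ha; simp [Finset.mem_symmDiff, he]
        · simp only [Finset.mem_symmDiff, Finset.mem_singleton, Finset.mem_union,
            Finset.mem_inter, Finset.mem_sdiff]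
          tauto
      rw [toggle_of_notMem h, toggle_of_notMem h']
  · have h' : (traceMap L F X).1 ∆ {e} ∉ trace L F := by
      intro h'
      obtain ⟨Y, hY, hYX⟩ := Finset.mem_image.1 h'
      have : e ∈ Y ∩ F := by
        rw [hYX]
        simp [traceMap, Finset.mem_symmDiff, he]
      exact he (Finset.mem_inter.1 this).2
    rw [toggle_of_notMem h']
    by_cases h : X.1 ∆ {e} ∈ L
    · apply Subtype.ext
      change (toggle L e X).1 ∩ F = X.1 ∩ F
      rw [toggle_val_of_mem h]
      ext a
      by_cases ha : a = e
      · subst ha; simp [he]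
      · simp [Finset.mem_symmDiff, ha]
    · rw [toggle_of_notMem h]

theorem exists_traceMap_apply (hF : ∀ X ∈ L, ∀ Y ∈ L, (X ∩ F) ∪ (Y \ F) ∈ L)
    {g : Equiv.Perm {A : Finset E // A ∈ L}} (hg : g ∈ toggleGroup L) :
    ∃ g' ∈ toggleGroup (trace L F), ∀ X, traceMap L F (g X) = g' (traceMap L F X) := by
  induction hg using toggleGroup_induction with
  | one => exact ⟨1, one_mem _, fun X => rfl⟩
  | toggle_mul e g hg ih =>
    obtain ⟨g', hg', h⟩ := ih
    exact ⟨toggle _ e * g', mul_mem (toggle_mem _ e) hg', fun X => by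
      simp [traceMap_toggle hF, h]⟩

theorem isCycle_of_exists_pow {α : Type*} [Fintype α] [DecidableEq α] {c : Equiv.Perm α}
    (hα : 1 < Fintype.card α) (hc : ∀ x y, ∃ n : ℕ, (c ^ n) x = y) :
    c.IsCycle ∧ c.support = Finset.univ := by
  have hmove : ∀ x, c x ≠ x := by
    intro x hx
    obtain ⟨y, hy⟩ := Fintype.exists_ne_of_one_lt_card hα x
    obtain ⟨n, rfl⟩ := hc x y
    exact hy (Equiv.Perm.pow_apply_eq_self_of_apply_eq_self hx n)
  have : Nontrivial α := Fintype.one_lt_card_iff_nontrivial.1 hα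
  obtain ⟨x, -⟩ := exists_pair_ne α
  refine ⟨⟨x, hmove x, fun y _ => ?_⟩, ?_⟩
  · obtain ⟨n, hn⟩ := hc x y
    exact ⟨n, by simpa using hn⟩
  · ext y
    simp [hmove y]

/-- A transitive cyclic subgroup of the toggle group induces a long cycle on the trace on a factor
of a product decomposition. -/
theorem exists_longCycle_trace (hF : ∀ X ∈ L, ∀ Y ∈ L, (X ∩ F) ∪ (Y \ F) ∈ L)
    (hcard : 2 ≤ (trace L F).card) {c : Equiv.Perm {A : Finset E // A ∈ L}}
    (hc : c ∈ toggleGroup L) (hct : ∀ X Y, ∃ n : ℕ, (c ^ n) X = Y) :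
    HasLongCycle (trace L F) ∧
      ∀ n, (trace L F).card ∣ n → ∀ X, traceMap L F ((c ^ n) X) = traceMap L F X := by
  obtain ⟨c', hc', h⟩ := exists_traceMap_apply hF hc
  have hpow : ∀ (n : ℕ) X, traceMap L F ((c ^ n) X) = (c' ^ n) (traceMap L F X) := by
    intro n
    induction n with
    | zero => intro X; rfl
    | succ n ih => intro X; rw [pow_succ', pow_succ', Equiv.Perm.mul_apply, h, ih]; rfl
  have hcyc := isCycle_of_exists_pow (c := c') (by rw [Fintype.card_coe]; exact hcard) (fun A B => by
    obtain ⟨X, rfl⟩ := traceMap_surjective A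
    obtain ⟨Y, rfl⟩ := traceMap_surjective B
    obtain ⟨n, rfl⟩ := hct X Y
    exact ⟨n, (hpow n X).symm⟩)
  have hord : orderOf c' = (trace L F).card := by
    rw [hcyc.1.orderOf, hcyc.2]
    simp
  refine ⟨⟨c', hc', hcyc⟩, fun n hn X => ?_⟩
  rw [hpow, orderOf_dvd_iff_pow_eq_one.1 (hord ▸ hn)]
  rfl

end Product

/-- an imprimitive transitive toggle group containing a long cycle
decomposes `L` as a toggle-disjoint Cartesian product of two factors of coprime
sizes at least 2, whose toggle groups each contain a long cycle. -/
theorem imprimitive_with_long_cycle_decomposes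
    [Fintype E] (L : Finset (Finset E))
    (hnt : ∀ e : E, toggle L e ≠ 1)
    (htrans : IsTransitive L)
    (himp : ∃ B : Finset {A : Finset E // A ∈ L},
      IsBlock L B ∧ 1 < B.card ∧ B.card < L.card)
    (hlong : HasLongCycle L) :
    ∃ E₁ E₂ : Finset E, Disjoint E₁ E₂ ∧
      ∃ L₁ L₂ : Finset (Finset E),
        (∀ X ∈ L₁, X ⊆ E₁) ∧ (∀ X ∈ L₂, X ⊆ E₂) ∧
        (∀ A : Finset E, A ∈ L ↔ ∃ X₁ ∈ L₁, ∃ X₂ ∈ L₂, A = X₁ ∪ X₂) ∧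
        2 ≤ L₁.card ∧ 2 ≤ L₂.card ∧ Nat.Coprime L₁.card L₂.card ∧
        HasLongCycle L₁ ∧ HasLongCycle L₂ := by
  classical
  obtain ⟨c, hc, hcyc, hsupp⟩ := hlong
  have hct : ∀ X Y, ∃ n : ℕ, (c ^ n) X = Y := fun X Y =>
    hcyc.exists_pow_eq (Equiv.Perm.mem_support.1 (hsupp ▸ Finset.mem_univ X))
      (Equiv.Perm.mem_support.1 (hsupp ▸ Finset.mem_univ Y))
  obtain ⟨B, hB, hB₁, hBL⟩ := himp
  obtain ⟨X, hX, Y, hY, hXY⟩ := Finset.one_lt_card.1 hB₁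
  obtain ⟨r, hr, hrB⟩ := hB.exists_isCongruence htrans ⟨X, hX⟩
  obtain ⟨Z, hZ⟩ : ∃ Z, Z ∉ B := by
    by_contra! h
    rw [Finset.eq_univ_iff_forall.2 h] at hBL
    simp at hBL
  let F : Finset E := Finset.univ.filter fun e => ∃ W, ¬ r W (toggle L e W)
  have hmemF : ∀ e, e ∈ F ↔ ∃ W, ¬ r W (toggle L e W) := by simp [F]
  have hagree : ∀ {X Y : {A : Finset E // A ∈ L}}, r X Y → X.1 ∩ F = Y.1 ∩ F := by
    intro X Y h
    ext e
    simp only [Finset.mem_inter, and_congr_left_iff]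
    exact fun he => hr.mem_iff_mem htrans ((hmemF e).1 he) hc hct h
  have htranslate : ∀ X Y : {A : Finset E // A ∈ L}, ∃ D ⊆ F, ∃ h : X.1 ∆ D ∈ L, r ⟨X.1 ∆ D, h⟩ Y := by
    intro X Y
    obtain ⟨g, hg, rfl⟩ := htrans X Y
    obtain ⟨D, hDF, hD⟩ := hr.exists_translate hg X
    exact ⟨D, fun e he => (hmemF e).2 (hDF e he), hD X (hr.equivalence.refl X)⟩
  have hF : ∀ X ∈ L, ∀ Y ∈ L, (X ∩ F) ∪ (Y \ F) ∈ L := by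
    intro X hX Y hY
    obtain ⟨D, hDF, h, hD⟩ := htranslate ⟨Y, hY⟩ ⟨X, hX⟩
    have hag : (Y ∆ D) ∩ F = X ∩ F := hagree hD
    convert h using 1
    rw [← hag]
    ext e
    have := @hDF e
    simp only [Finset.mem_symmDiff, Finset.mem_union, Finset.mem_inter, Finset.mem_sdiff]
    tauto
  have hF' : ∀ X ∈ L, ∀ Y ∈ L, (X ∩ Fᶜ) ∪ (Y \ Fᶜ) ∈ L := by
    intro X hX Y hY
    convert hF Y hY X hX using 1
    ext e
    simp only [Finset.mem_union, Finset.mem_inter, Finset.mem_sdiff, Finset.mem_compl]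
    tauto
  have hsplit : ∀ A : Finset E, (A ∩ F) ∪ (A ∩ Fᶜ) = A := fun A => by
    rw [← Finset.inter_union_distrib_left, Finset.union_compl, Finset.inter_univ]
  have hcard₁ : 2 ≤ (trace L F).card := by
    refine Finset.one_lt_card.2 ⟨_, (traceMap L F X).2, _, (traceMap L F Z).2, fun h => hZ ?_⟩
    obtain ⟨D, hDF, hm, hD⟩ := htranslate X Z
    have hag : (X.1 ∆ D) ∩ F = X.1 ∩ F := (hagree hD).trans h.symm
    have hXD : X.1 ∆ D = X.1 := by
      ext e
      have h₁ := Finset.ext_iff.1 hag e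
      have h₂ := @hDF e
      simp only [Finset.mem_symmDiff, Finset.mem_inter] at h₁ ⊢
      tauto
    simp only [hXD] at hD
    exact (hrB X hX Z).1 hD
  have hcard₂ : 2 ≤ (trace L Fᶜ).card := by
    refine Finset.one_lt_card.2 ⟨_, (traceMap L Fᶜ X).2, _, (traceMap L Fᶜ Y).2,
      fun h => hXY (Subtype.ext ?_)⟩
    change X.1 ∩ Fᶜ = Y.1 ∩ Fᶜ at h
    rw [← hsplit X.1, h, hagree ((hrB X hX Y).2 hY), hsplit]
  obtain ⟨hlong₁, hfix₁⟩ := exists_longCycle_trace hF hcard₁ hc hct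
  obtain ⟨hlong₂, hfix₂⟩ := exists_longCycle_trace hF' hcard₂ hc hct
  have hprod : ∀ A : Finset E,
      A ∈ L ↔ ∃ X₁ ∈ trace L F, ∃ X₂ ∈ trace L Fᶜ, A = X₁ ∪ X₂ := by
    intro A
    constructor
    · intro hA
      exact ⟨_, (traceMap L F ⟨A, hA⟩).2, _, (traceMap L Fᶜ ⟨A, hA⟩).2, (hsplit A).symm⟩
    · rintro ⟨_, h₁, _, h₂, rfl⟩
      obtain ⟨P, hP, rfl⟩ := Finset.mem_image.1 h₁
      obtain ⟨Q, hQ, rfl⟩ := Finset.mem_image.1 h₂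
      rw [← Finset.sdiff_eq_inter_compl]
      exact hF P hP Q hQ
  refine ⟨F, Fᶜ, disjoint_compl_right, trace L F, trace L Fᶜ, ?_, ?_, hprod, hcard₁, hcard₂,
    ?_, hlong₁, hlong₂⟩
  · intro A hA
    obtain ⟨P, -, rfl⟩ := Finset.mem_image.1 hA
    exact Finset.inter_subset_right
  · intro A hA
    obtain ⟨P, -, rfl⟩ := Finset.mem_image.1 hA
    exact Finset.inter_subset_right
  · have hord : orderOf c = L.card := by
      rw [hcyc.orderOf, hsupp]
      simp
    have hdvd : orderOf c ∣ (trace L F).card.lcm (trace L Fᶜ).card := by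
      refine orderOf_dvd_of_pow_eq_one (Equiv.ext fun X => Subtype.ext ?_)
      have h₁ := congrArg Subtype.val (hfix₁ _ (Nat.dvd_lcm_left _ (trace L Fᶜ).card) X)
      have h₂ := congrArg Subtype.val (hfix₂ _ (Nat.dvd_lcm_right (trace L F).card _) X)
      change _ ∩ F = X.1 ∩ F at h₁
      change _ ∩ Fᶜ = X.1 ∩ Fᶜ at h₂
      rw [← hsplit (Subtype.val _), h₁, h₂, hsplit]
      rfl
    have hle : (trace L F).card * (trace L Fᶜ).card ≤ L.card := by
      rw [← Finset.card_product]
      refine Finset.card_le_card_of_injOn (fun p => p.1 ∪ p.2) ?_ ?_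
      · rintro ⟨P, Q⟩ hPQ
        have := Finset.mem_product.1 hPQ
        exact (hprod _).2 ⟨P, this.1, Q, this.2, rfl⟩
      · have hval : ∀ p ∈ trace L F ×ˢ trace L Fᶜ,
            (p.1 ∪ p.2) ∩ F = p.1 ∧ (p.1 ∪ p.2) ∩ Fᶜ = p.2 := by
          rintro ⟨_, _⟩ hPQ
          obtain ⟨h₁, h₂⟩ := Finset.mem_product.1 hPQ
          obtain ⟨P, -, rfl⟩ := Finset.mem_image.1 h₁
          obtain ⟨Q, -, rfl⟩ := Finset.mem_image.1 h₂
          constructor <;> ext e <;>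
            simp only [Finset.mem_union, Finset.mem_inter, Finset.mem_compl] <;> tauto
        intro p hp q hq hpq
        change p.1 ∪ p.2 = q.1 ∪ q.2 at hpq
        apply Prod.ext
        · rw [← (hval p hp).1, hpq, (hval q hq).1]
        · rw [← (hval p hp).2, hpq, (hval q hq).2]
    have hlcm := Nat.le_of_dvd (Nat.lcm_pos (by omega) (by omega)) hdvd
    have hgl := Nat.gcd_mul_lcm (trace L F).card (trace L Fᶜ).card
    have hpos : 0 < (trace L F).card.lcm (trace L Fᶜ).card :=
      Nat.lcm_pos (by omega) (by omega)
    have hgpos : 0 < (trace L F).card.gcd (trace L Fᶜ).card := Nat.gcd_pos_of_pos_left _ (by omega)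
    have hg : (trace L F).card.gcd (trace L Fᶜ).card ≤ 1 := by
      by_contra! h
      nlinarith
    exact le_antisymm hg hgpos

end TogglePaper
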